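/- arXiv:1606.03862 — 2 statements merged into one kernel-verified Lean document; each statement's English description precedes it below -/
import Mathlib

section
/- Every finite conical refinement monoid is a graph monoid: if M is a conical refinement monoid with finitely many elements, there exists a countable row-finite directed graph E with M ≅ M(E). -/
namespace ArPardo

/-- A countable row-finite directed graph `E = (E⁰, E¹, s, r)`. -/
structure RowFiniteGraph : Type 1 where
  V : Type
  E : Type
  countableV : Countable V
  countableE : Countable E
  s : E → V
  r : E → V
  rowFinite : ∀ v : V, {e : E | s e = v}.Finite

/-- The defining relations of the graph monoid, as a relation on the free
commutative monoid `V →₀ ℕ` on the vertices: for every vertex `v` emitting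
at least one edge, `a_v = Σ_{e ∈ s⁻¹(v)} a_{r(e)}`. -/
def graphRel (G : RowFiniteGraph) (x y : G.V →₀ ℕ) : Prop :=
  ∃ v : G.V, (∃ e : G.E, G.s e = v) ∧ x = Finsupp.single v 1 ∧
    y = ∑ e ∈ (G.rowFinite v).toFinset, Finsupp.single (G.r e) 1

/-- The graph monoid `M(E)`: the quotient of the free commutative monoid on the
vertices by the congruence generated by the graph relations. -/
def graphMonoid (G : RowFiniteGraph) : Type :=
  (addConGen (graphRel G)).Quotient

noncomputable instance (G : RowFiniteGraph) : AddCommMonoid (graphMonoid G) :=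
  inferInstanceAs (AddCommMonoid (addConGen (graphRel G)).Quotient)

/-- The canonical generator `a_v` of the graph monoid. -/
noncomputable def vertexElem (G : RowFiniteGraph) (v : G.V) : graphMonoid G :=
  (addConGen (graphRel G)).mk' (Finsupp.single v 1)

/-- A commutative monoid is a graph monoid if it is isomorphic to `M(E)` for some
(countable) row-finite directed graph `E`. -/
def IsGraphMonoid (M : Type) [AddCommMonoid M] : Prop :=
  ∃ G : RowFiniteGraph, Nonempty (M ≃+ graphMonoid G)

/-- The algebraic preorder on a commutative monoid: `x ≤ y` iff `y = x + z`. -/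
def algLE {M : Type} [AddCommMonoid M] (x y : M) : Prop :=
  ∃ z : M, y = x + z

/-- A commutative monoid is conical if `x + y = 0` implies `x = y = 0`. -/
def IsConical (M : Type) [AddCommMonoid M] : Prop :=
  ∀ x y : M, x + y = 0 → x = 0 ∧ y = 0

/-- The Riesz refinement property. -/
def IsRefinement (M : Type) [AddCommMonoid M] : Prop :=
  ∀ a b c d : M, a + b = c + d →
    ∃ w x y z : M, a = w + x ∧ b = y + z ∧ c = w + y ∧ d = x + z

/-- A prime element: not invertible, and `p ≤ a + b` implies `p ≤ a` or `p ≤ b`. -/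
def IsPrimeElem {M : Type} [AddCommMonoid M] (p : M) : Prop :=
  (∀ q : M, p + q ≠ 0) ∧ ∀ a b : M, algLE p (a + b) → algLE p a ∨ algLE p b

/-- A free element: `n • p ≤ m • p` implies `n ≤ m`. -/
def IsFreeElem {M : Type} [AddCommMonoid M] (p : M) : Prop :=
  ∀ n m : ℕ, algLE (n • p) (m • p) → n ≤ m

/-- A regular element: `2x ≤ x`. -/
def IsRegularElem {M : Type} [AddCommMonoid M] (x : M) : Prop :=
  algLE (x + x) x

/-- `q̄ < p̄` in the poset of (classes of) elements: `q ≤ p` and `p ≰ q`. -/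
def classLT {M : Type} [AddCommMonoid M] (q p : M) : Prop :=
  algLE q p ∧ ¬ algLE p q

/-- `q` is a prime whose class lies in the lower cover of the class of the prime `p`:
`q̄ < p̄` and no prime class lies strictly between. -/
def InLowerCover {M : Type} [AddCommMonoid M] (p q : M) : Prop :=
  IsPrimeElem q ∧ classLT q p ∧
    ¬ ∃ t : M, IsPrimeElem t ∧ classLT q t ∧ classLT t p

/-- `Q` is a (finite) set of representatives of the classes in the lower cover of `p̄`:
its elements are in the lower cover, pairwise inequivalent, and every prime in the
lower cover is equivalent to one of them. -/
def IsLowerCoverReps {M : Type} [AddCommMonoid M] (p : M) (Q : Finset M) : Prop :=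
  (∀ q ∈ Q, InLowerCover p q) ∧
  (∀ q ∈ Q, ∀ q' ∈ Q, algLE q q' → algLE q' q → q = q') ∧
  (∀ t : M, InLowerCover p t → ∃ q ∈ Q, algLE q t ∧ algLE t q)

/-- The underlying set of the group `G'_p = {p + α : α ∈ M, p + α ≤ p}`. -/
def GpSet {M : Type} [AddCommMonoid M] (p : M) : Set M :=
  {y | ∃ α : M, y = p + α ∧ algLE y p}

/-- `j : G' → M` realizes the abelian group `G'` as the group
`G'_p = {p + α : p + α ≤ p}` with identity `p` and operation
`(p + α) ∘ (p + β) = p + (α + β)`. -/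
structure GpStructure (M : Type) [AddCommMonoid M] (p : M)
    (G' : Type) [AddCommGroup G'] (j : G' → M) : Prop where
  inj : Function.Injective j
  range_eq : Set.range j = GpSet p
  map_zero : j 0 = p
  map_add : ∀ (u v : G') (α β : M), j u = p + α → j v = p + β → j (u + v) = p + (α + β)

/-- The archimedean component of `s`: all `a` with `a ≤ n • s` and `s ≤ m • a` for
some positive integers `n, m`; it is a subsemigroup. -/
def archComp {M : Type} [AddCommMonoid M] (s : M) : AddSubsemigroup M where
  carrier := {a : M | ∃ n m : ℕ, 0 < n ∧ 0 < m ∧ algLE a (n • s) ∧ algLE s (m • a)}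
  add_mem' := by
    rintro a b ⟨n, m, hn, hm, ⟨z, hz⟩, ⟨w, hw⟩⟩ ⟨n', m', hn', hm', ⟨z', hz'⟩, ⟨w', hw'⟩⟩
    refine ⟨n + n', m, Nat.add_pos_left hn _, hm, ⟨z + z', ?_⟩, ⟨w + m • b, ?_⟩⟩
    · rw [add_nsmul, hz, hz']; abel
    · rw [nsmul_add, hw]; abel

/-- `(Γ, ι)` is a Grothendieck group of the commutative semigroup `S`: every
semigroup homomorphism from `S` to an abelian group factors uniquely through `ι`. -/
def IsGrothendieck (S : Type) [Add S] (Γ : Type) [AddCommGroup Γ] (ι : AddHom S Γ) : Prop :=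
  ∀ (A : Type) [AddCommGroup A], ∀ f : AddHom S A, ∃! g : Γ →+ A, ∀ x : S, g (ι x) = f x

/-- The almost-isomorphism condition at a free prime `p`, with `Q` a set of
representatives of the lower cover of `p̄`, and `s_p = Σ_{q ∈ Q} q`: for every
Grothendieck group `ι : M_{J_p} → Γ` of the archimedean component `M_{J_p}` of `s_p`,
every realization `(G', j)` of the group `G'_p`, every incarnation
`φp : M_{J_p} → G'` of the map `x ↦ p + x`, the unique group homomorphism
`ψ = G(φ_p) : Γ → G'` with `ψ ∘ ι = φp` is surjective and its kernel is the cyclic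
subgroup generated by `ι x` for some `x ∈ M_{J_p}`. -/
def AlmostIsoCondition (M : Type) [AddCommMonoid M] (p : M) (Q : Finset M) : Prop :=
  ∀ (Γ : Type) [AddCommGroup Γ],
    ∀ ι : AddHom (archComp (∑ q ∈ Q, (q : M))) Γ,
    IsGrothendieck (archComp (∑ q ∈ Q, (q : M))) Γ ι →
    ∀ (G' : Type) [AddCommGroup G'], ∀ j : G' → M, GpStructure M p G' j →
    ∀ φp : AddHom (archComp (∑ q ∈ Q, (q : M))) G',
      (∀ a : archComp (∑ q ∈ Q, (q : M)), j (φp a) = p + (a : M)) →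
    ∀ ψ : Γ →+ G', (∀ a, ψ (ι a) = φp a) →
      Function.Surjective ψ ∧
        ∃ x : archComp (∑ q ∈ Q, (q : M)), ψ.ker = AddSubgroup.zmultiples (ι x)

/-- An order-ideal of a commutative monoid. -/
def IsOrderIdeal {M : Type} [AddCommMonoid M] (S : Set M) : Prop :=
  (0 : M) ∈ S ∧ (∀ x y : M, x ∈ S → y ∈ S → x + y ∈ S) ∧
    ∀ x y : M, algLE x y → y ∈ S → x ∈ S

/-- The order-ideal generated by a subset: the smallest order-ideal containing it. -/
def orderIdealGen {M : Type} [AddCommMonoid M] (X : Set M) : Set M :=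
  ⋂₀ {S : Set M | IsOrderIdeal S ∧ X ⊆ S}

/-- The restriction graph `E_H` of a hereditary subset `H` of the vertices. -/
def restrictGraph (G : RowFiniteGraph) (H : Set G.V)
    (hher : ∀ e : G.E, G.s e ∈ H → G.r e ∈ H) : RowFiniteGraph where
  V := ↥H
  E := {e : G.E // G.s e ∈ H}
  countableV := by have := G.countableV; exact inferInstance
  countableE := by have := G.countableE; exact inferInstance
  s := fun e => ⟨G.s e.1, e.2⟩
  r := fun e => ⟨G.r e.1, hher e.1 e.2⟩
  rowFinite := fun v => by
    have hsub : {e : {e : G.E // G.s e ∈ H} | (⟨G.s e.1, e.2⟩ : ↥H) = v}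
        ⊆ Subtype.val ⁻¹' {e : G.E | G.s e = (v : G.V)} := by
      intro e he
      simpa [Subtype.ext_iff] using he
    exact Set.Finite.subset
      (Set.Finite.preimage (Subtype.val_injective.injOn) (G.rowFinite (v : G.V))) hsub

section Order

variable {M : Type} [AddCommMonoid M]

theorem algLE_refl (x : M) : algLE x x := ⟨0, (add_zero x).symm⟩

theorem algLE.trans {x y z : M} (hxy : algLE x y) (hyz : algLE y z) : algLE x z := by
  obtain ⟨a, rfl⟩ := hxy
  obtain ⟨b, rfl⟩ := hyz
  exact ⟨a + b, add_assoc x a b⟩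

theorem algLE_add_right (x y : M) : algLE x (x + y) := ⟨y, rfl⟩

theorem algLE_add_left (x y : M) : algLE x (y + x) := ⟨y, add_comm y x⟩

theorem algLE.add {x y x' y' : M} (h : algLE x y) (h' : algLE x' y') :
    algLE (x + x') (y + y') := by
  obtain ⟨a, rfl⟩ := h
  obtain ⟨b, rfl⟩ := h'
  exact ⟨a + b, add_add_add_comm x a x' b⟩

/-- What is absorbed by an element is absorbed by every larger element. -/
theorem algLE.add_eq_of_add_eq {x y w : M} (h : algLE x y) (hx : x + w = x) : y + w = y := by
  obtain ⟨a, rfl⟩ := h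
  rw [add_right_comm, hx]

theorem nsmul_absorbed {x w : M} (hx : x + w = x) (n : ℕ) : x + n • w = x := by
  induction n with
  | zero => simp
  | succ n ih => rw [succ_nsmul, ← add_assoc, ih, hx]

theorem classLT_wf [Finite M] : WellFounded (classLT : M → M → Prop) := by
  have : Std.Irrefl (classLT : M → M → Prop) := ⟨fun _ h => h.2 h.1⟩
  have : IsTrans M classLT :=
    ⟨fun _ _ _ h h' => ⟨h.1.trans h'.1, fun h'' => h.2 (h'.1.trans h'')⟩⟩
  exact Finite.wellFounded_of_trans_of_irrefl _

/-- An element that is not a sum of two strictly smaller ones is prime. -/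
theorem isPrimeElem_of_indecomposable (hcon : IsConical M) (href : IsRefinement M) {a : M}
    (ha : a ≠ 0) (h : ∀ b c, a = b + c → algLE a b ∨ algLE a c) : IsPrimeElem a := by
  refine ⟨fun q hq => ha (hcon a q hq).1, ?_⟩
  rintro b c ⟨z, hz⟩
  obtain ⟨w, x, y, t, hb, hc, rfl, -⟩ := href b c a z hz
  rcases h w y rfl with h | h
  · exact Or.inl (h.trans ⟨x, hb⟩)
  · exact Or.inr (h.trans ⟨t, hc⟩)

/-- A finite conical refinement monoid is primely generated. -/
theorem closure_isPrimeElem_eq_top [Finite M] (hcon : IsConical M) (href : IsRefinement M) :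
    AddSubmonoid.closure {p : M | IsPrimeElem p} = ⊤ := by
  rw [eq_top_iff]
  rintro a -
  induction a using (classLT_wf (M := M)).induction with
  | _ a ih =>
    by_cases ha : a = 0
    · exact ha ▸ zero_mem _
    by_cases h : ∀ b c, a = b + c → algLE a b ∨ algLE a c
    · exact AddSubmonoid.subset_closure (isPrimeElem_of_indecomposable hcon href ha h)
    · push Not at h
      obtain ⟨b, c, rfl, hb, hc⟩ := h
      exact add_mem (ih b ⟨algLE_add_right b c, hb⟩) (ih c ⟨algLE_add_left c b, hc⟩)

/-- If `p` is prime, `(n + 2) p ≥ (n + 3) p` implies `(n + 1) p ≥ (n + 2) p`. -/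
theorem IsPrimeElem.nsmul_descent (href : IsRefinement M) {p : M} (hp : IsPrimeElem p) {n : ℕ}
    (h : algLE ((n + 3) • p) ((n + 2) • p)) : algLE ((n + 2) • p) ((n + 1) • p) := by
  obtain ⟨z, hz⟩ := h
  have hsplit : p + (n + 1) • p = p + ((n + 2) • p + z) := by
    rw [← add_assoc, ← succ_nsmul', ← succ_nsmul', hz]
  obtain ⟨w, x, y, t, h₁, h₂, h₃, h₄⟩ := href _ _ _ _ hsplit
  have hle : algLE ((n + 2) • p) (x + t) := ⟨z, h₄.symm⟩
  by_cases hw : algLE p w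
  · obtain ⟨s, hs⟩ := hw
    have hpx : algLE (x + p) p := ⟨s, by
      calc p = w + x := h₁
        _ = x + p + s := by rw [hs]; abel⟩
    have ht : algLE t ((n + 1) • p) := h₂ ▸ algLE_add_left t y
    refine hle.trans (((algLE_refl x).add ht).trans ?_)
    rw [succ_nsmul', ← add_assoc]
    exact hpx.add (algLE_refl _)
  · have hy : algLE p y := (hp.2 w y (h₃ ▸ algLE_refl p)).resolve_left hw
    have hxy : algLE x y := (h₁ ▸ algLE_add_left x w : algLE x p).trans hy
    exact h₂ ▸ hle.trans (hxy.add (algLE_refl t))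

/-- Primes of a finite refinement monoid are regular. -/
theorem IsPrimeElem.isRegularElem [Finite M] (href : IsRefinement M) {p : M}
    (hp : IsPrimeElem p) : IsRegularElem p := by
  have descend : ∀ n : ℕ, algLE ((n + 2) • p) ((n + 1) • p) → IsRegularElem p := by
    intro n
    induction n with
    | zero => intro h; simpa [IsRegularElem, two_nsmul] using h
    | succ n ih => exact fun h => ih (hp.nsmul_descent href h)
  obtain ⟨i, j, hij, heq⟩ := Finite.exists_ne_map_eq_of_infinite fun n : ℕ => n • p
  wlog hlt : i < j generalizing i j
  · exact this j i hij.symm heq.symm (by omega)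
  obtain ⟨k, rfl⟩ := Nat.exists_eq_add_of_lt hlt
  refine descend i ⟨k • p, ?_⟩
  rw [succ_nsmul, heq, ← succ_nsmul, ← add_nsmul]
  congr 1
  omega

theorem IsRegularElem.exists_period [Finite M] {g : M} (hg : IsRegularElem g) :
    ∃ k : ℕ, g + (k + 1) • g = g := by
  obtain ⟨z, hz⟩ := hg
  obtain ⟨i, j, hij, heq⟩ := Finite.exists_ne_map_eq_of_infinite fun n : ℕ => n • g
  wlog hlt : i < j generalizing i j
  · exact this j i hij.symm heq.symm (by omega)
  obtain ⟨k, rfl⟩ := Nat.exists_eq_add_of_lt hlt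
  have habs : g + i • (g + z) = g := nsmul_absorbed (by rw [← add_assoc, ← hz]) i
  refine ⟨k, algLE.add_eq_of_add_eq (x := i • g) ⟨g + i • z, ?_⟩ ?_⟩
  · calc g = g + i • (g + z) := habs.symm
      _ = i • g + (g + i • z) := by rw [nsmul_add]; abel
  · rw [← add_nsmul, ← add_assoc]
    exact heq.symm

end Order

section Graph

variable {V : Type} [Countable V]

/-- The graph in which `v` emits one edge to each entry of the list `l v`. -/
def listGraph (l : V → List V) : RowFiniteGraph where
  V := V
  E := Σ v, Fin (l v).length
  countableV := inferInstance
  countableE := inferInstance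
  s := Sigma.fst
  r := fun e => (l e.1).get e.2
  rowFinite := fun v => (Set.finite_range (Sigma.mk v)).subset (by
    rintro ⟨u, i⟩ (rfl : u = v)
    exact ⟨i, rfl⟩)

theorem sum_listGraph (l : V → List V) (v : V) :
    ∑ e ∈ ((listGraph l).rowFinite v).toFinset, Finsupp.single ((listGraph l).r e) 1 =
      ((l v).map fun u => Finsupp.single u 1).sum := by
  have sum_fiber (s : Finset (Σ v, Fin (l v).length)) (hs : ∀ e, e ∈ s ↔ e.1 = v) :
      ∑ e ∈ s, Finsupp.single ((l e.1).get e.2) 1 =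
        ((l v).map fun u => Finsupp.single u 1).sum := by
    have h : s = Finset.univ.map
        (Function.Embedding.sigmaMk (β := fun v => Fin (l v).length) v) := by
      ext ⟨u, i⟩
      simp only [hs, Finset.mem_map, Finset.mem_univ, true_and,
        Function.Embedding.sigmaMk_apply]
      constructor
      · rintro rfl
        exact ⟨i, rfl⟩
      · rintro ⟨j, hj⟩
        exact (congrArg Sigma.fst hj).symm
    rw [h, Finset.sum_map]
    exact Fin.sum_univ_fun_getElem (l v) fun u => Finsupp.single u 1
  exact sum_fiber _ fun e => Set.Finite.mem_toFinset _

/-- The graph in which the relation at `v` is `a_v = a_v + W v`. -/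
noncomputable def absorptionGraph (W : V → V →₀ ℕ) : RowFiniteGraph :=
  listGraph fun v => v :: (Finsupp.toMultiset (W v)).toList

theorem graphRel_absorptionGraph (W : V → V →₀ ℕ) (x y : V →₀ ℕ) :
    graphRel (absorptionGraph W) x y ↔
      ∃ v : V, x = Finsupp.single v 1 ∧ y = Finsupp.single v 1 + W v := by
  classical
  have hsum (v : V) : ∑ e ∈ ((absorptionGraph W).rowFinite v).toFinset,
      Finsupp.single ((absorptionGraph W).r e) 1 = Finsupp.single v 1 + W v := by
    refine (sum_listGraph _ v).trans ?_
    rw [List.map_cons, List.sum_cons, ← Multiset.sum_coe, ← Multiset.map_coe,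
      Multiset.coe_toList]
    congr 1
    induction W v using Finsupp.induction_linear with
    | zero => simp
    | add f g hf hg => simp [hf, hg]
    | single a n => simp [Finsupp.toMultiset_single, Multiset.map_nsmul, Multiset.sum_nsmul]
  constructor
  · rintro ⟨v, -, hx, hy⟩
    exact ⟨v, hx, hy.trans (hsum v)⟩
  · rintro ⟨v, hx, hy⟩
    exact ⟨v, ⟨⟨v, ⟨0, Nat.succ_pos _⟩⟩, rfl⟩, hx, hy.trans (hsum v).symm⟩

end Graph

/-- Induction on formal sums, adding one vertex at a time. -/
theorem word_induction {V : Type} {P : (V →₀ ℕ) → Prop} (zero : P 0)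
    (add : ∀ v x, P x → P (Finsupp.single v 1 + x)) (x : V →₀ ℕ) : P x := by
  induction x using Finsupp.induction with
  | zero => exact zero
  | single_add v n x _ _ ih =>
    clear * - ih add
    induction n with
    | zero => simpa using ih
    | succ n hn =>
      rw [add_comm n 1, Finsupp.single_add, add_assoc]
      exact add v _ hn

section Construction

variable {M : Type} [AddCommMonoid M]

/-- Vertices of the graph representing `M`: countably many copies of each prime. -/
abbrev PrimeVertex (M : Type) [AddCommMonoid M] : Type :=
  {p : M // IsPrimeElem p} × Bool × ℕ

/-- The class of `v` in the free commutative monoid on the vertices. -/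
noncomputable abbrev vtx (v : PrimeVertex M) : PrimeVertex M →₀ ℕ := Finsupp.single v 1

/-- Evaluation of formal sums of vertices in `M`. -/
noncomputable def evalWord : (PrimeVertex M →₀ ℕ) →+ M :=
  Finsupp.liftAddHom fun v => multiplesHom M v.1.1

@[simp]
theorem evalWord_single (v : PrimeVertex M) (n : ℕ) :
    evalWord (Finsupp.single v n) = n • v.1.1 := by
  simp [evalWord]

variable [Finite M]

open Classical in
/-- The word absorbed by a vertex, where `k p + 1` is a period of the prime `p` and `w`
enumerates all words. Copies with tag `true` ensure that a vertex lies above every vertex of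
a smaller or equivalent prime; copies with tag `false` run through the words absorbed in `M`. -/
noncomputable def absorbedWord (k : {p : M // IsPrimeElem p} → ℕ)
    (w : ℕ → PrimeVertex M →₀ ℕ) : PrimeVertex M → PrimeVertex M →₀ ℕ
  | (g, b, n) =>
    (if b then (k g + 1) • vtx (g, true, n + 1) + (k g + 1) • vtx (g, false, n)
      else if g.1 + evalWord (w n) = g.1 then w n else 0) +
    ∑ h ∈ (Set.toFinite {h : {p : M // IsPrimeElem p} | algLE h.1 g.1}).toFinset,
      (k h + 1) • vtx (h, true, 0)

variable {k : {p : M // IsPrimeElem p} → ℕ} {w : ℕ → PrimeVertex M →₀ ℕ}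

theorem add_evalWord_absorbedWord (hk : ∀ p, p.1 + (k p + 1) • p.1 = p.1) (v : PrimeVertex M) :
    v.1.1 + evalWord (absorbedWord k w v) = v.1.1 := by
  obtain ⟨g, b, n⟩ := v
  have hsum (s : Finset {p : M // IsPrimeElem p}) (hs : ∀ h ∈ s, algLE h.1 g.1) :
      g.1 + ∑ h ∈ s, (k h + 1) • h.1 = g.1 := by
    classical
    induction s using Finset.induction_on with
    | empty => simp
    | insert a s ha ih =>
      rw [Finset.sum_insert ha, ← add_assoc,
        (hs a (Finset.mem_insert_self a s)).add_eq_of_add_eq (hk a)]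
      exact ih fun h hh => hs h (Finset.mem_insert_of_mem hh)
  have hsum' := hsum (Set.toFinite {h : {p : M // IsPrimeElem p} | algLE h.1 g.1}).toFinset
    (by simp)
  simp only [absorbedWord, map_add, map_sum, map_nsmul, evalWord_single, one_nsmul]
  rw [add_comm (evalWord _), ← add_assoc, hsum']
  split_ifs with h₁ h₂
  · simp only [map_add, map_nsmul, evalWord_single, one_nsmul]
    rw [← add_assoc, hk, hk]
  · exact h₂
  · simp

section Absorption

variable {Q : Type} [AddCommMonoid Q] {π : (PrimeVertex M →₀ ℕ) →+ Q}

theorem algLE_of_algLE_absorbedWord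
    (hπ : ∀ v, π (vtx v) = π (vtx v) + π (absorbedWord k w v)) {x : Q} {v : PrimeVertex M}
    (h : algLE x (π (absorbedWord k w v))) : algLE x (π (vtx v)) :=
  hπ v ▸ h.trans (algLE_add_left _ _)

theorem vtx_algLE_vtx (hπ : ∀ v, π (vtx v) = π (vtx v) + π (absorbedWord k w v))
    {u v : PrimeVertex M} (huv : algLE u.1.1 v.1.1) : algLE (π (vtx u)) (π (vtx v)) := by
  classical
  have base (n : ℕ) (x : Q) : algLE x ((n + 1) • x) := ⟨n • x, succ_nsmul' x n⟩
  obtain ⟨h, b, m⟩ := u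
  have root : algLE (π (vtx (h, true, 0))) (π (vtx v)) := by
    obtain ⟨g, c, n⟩ := v
    apply algLE_of_algLE_absorbedWord hπ
    have hmem : h ∈ (Set.toFinite {h : {p : M // IsPrimeElem p} | algLE h.1 g.1}).toFinset :=
      (Set.Finite.mem_toFinset _).2 huv
    rw [absorbedWord, map_add, map_sum, ← Finset.add_sum_erase _ _ hmem, map_nsmul]
    exact ((base _ _).trans (algLE_add_right _ _)).trans (algLE_add_left _ _)
  have step (n : ℕ) : algLE (π (vtx (h, true, n + 1))) (π (vtx (h, true, n))) ∧
      algLE (π (vtx (h, false, n))) (π (vtx (h, true, n))) := by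
    constructor <;> apply algLE_of_algLE_absorbedWord hπ <;>
      simp only [absorbedWord, if_true, map_add, map_nsmul]
    · exact ((base _ _).trans (algLE_add_right _ _)).trans (algLE_add_right _ _)
    · exact ((base _ _).trans (algLE_add_left _ _)).trans (algLE_add_right _ _)
  have chain (n : ℕ) : algLE (π (vtx (h, true, n))) (π (vtx v)) := by
    induction n with
    | zero => exact root
    | succ n ih => exact (step n).1.trans ih
  cases b
  · exact (step m).2.trans (chain m)
  · exact chain m

/-- Whatever is absorbed by a prime in `M` is absorbed by each of its copies. -/
theorem vtx_add_eq_of_absorbed (hw : Function.Surjective w)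
    (hπ : ∀ v, π (vtx v) = π (vtx v) + π (absorbedWord k w v)) {v : PrimeVertex M}
    {x : PrimeVertex M →₀ ℕ} (hx : v.1.1 + evalWord x = v.1.1) :
    π (vtx v) + π x = π (vtx v) := by
  classical
  obtain ⟨n, rfl⟩ := hw x
  obtain ⟨m, hm⟩ := hw 0
  have h (i : ℕ) : π (vtx v) + π (absorbedWord k w (v.1, false, i)) = π (vtx v) :=
    (vtx_algLE_vtx (u := (v.1, false, i)) hπ (algLE_refl v.1.1)).add_eq_of_add_eq (hπ (v.1, false, i)).symm
  have h₀ := h m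
  have h₁ := h n
  simp only [absorbedWord, hm, hx, ite_self, if_true, Bool.false_eq_true, if_false, zero_add,
    map_add] at h₀ h₁
  rwa [add_comm (π (w n)), ← add_assoc, h₀] at h₁

/-- A word evaluating to a prime represents the copies of that prime. -/
theorem map_word_eq_map_vtx (hk : ∀ p, p.1 + (k p + 1) • p.1 = p.1)
    (hw : Function.Surjective w)
    (hπ : ∀ v, π (vtx v) = π (vtx v) + π (absorbedWord k w v)) {v : PrimeVertex M}
    {x : PrimeVertex M →₀ ℕ} (hx : evalWord x = v.1.1) : π x = π (vtx v) := by
  have exists_ge (x : PrimeVertex M →₀ ℕ) (hx : algLE v.1.1 (evalWord x)) :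
      ∃ u y, algLE v.1.1 u.1.1 ∧ x = vtx u + y := by
    induction x using word_induction with
    | zero =>
      obtain ⟨z, hz⟩ := hx
      exact absurd (hz.symm.trans (map_zero _)) (v.1.2.1 z)
    | add u x ih =>
      rw [map_add, evalWord_single, one_nsmul] at hx
      rcases v.1.2.2 _ _ hx with h | h
      · exact ⟨u, x, h, rfl⟩
      · obtain ⟨u', y, hu', rfl⟩ := ih h
        exact ⟨u', vtx u + y, hu', add_left_comm _ _ _⟩
  obtain ⟨u, y, hvu, rfl⟩ := exists_ge x (hx ▸ algLE_refl _)
  have hu : π (vtx u) + π ((k v.1 + 1) • vtx v) = π (vtx u) := by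
    apply vtx_add_eq_of_absorbed hw hπ
    rw [map_nsmul, evalWord_single, one_nsmul]
    exact hvu.add_eq_of_add_eq (hk v.1)
  have hv : π (vtx v) + π (vtx u + y + k v.1 • vtx v) = π (vtx v) := by
    apply vtx_add_eq_of_absorbed hw hπ
    rw [map_add, hx, map_nsmul, evalWord_single, one_nsmul, ← succ_nsmul']
    exact hk v.1
  calc π (vtx u + y) = π (vtx u) + π ((k v.1 + 1) • vtx v) + π y := by rw [hu, map_add]
    _ = π (vtx v) + π (vtx u + y + k v.1 • vtx v) := by
      simp only [← map_add]
      congr 1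
      rw [succ_nsmul]
      abel
    _ = π (vtx v) := hv

/-- Every element of a finite conical refinement monoid is the value of a word. -/
theorem evalWord_surjective (hcon : IsConical M) (href : IsRefinement M) :
    Function.Surjective (evalWord (M := M)) := by
  rw [← AddMonoidHom.mrange_eq_top, eq_top_iff, ← closure_isPrimeElem_eq_top hcon href,
    AddSubmonoid.closure_le]
  intro p hp
  exact ⟨vtx (⟨p, hp⟩, true, 0), by simp⟩

/-- Decompositions of the value of a word lift to decompositions of the element it
represents. -/
theorem exists_word_split (hcon : IsConical M) (href : IsRefinement M)
    (hk : ∀ p, p.1 + (k p + 1) • p.1 = p.1) (hw : Function.Surjective w)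
    (hπ : ∀ v, π (vtx v) = π (vtx v) + π (absorbedWord k w v)) (x : PrimeVertex M →₀ ℕ) :
    ∀ b c, evalWord x = b + c → ∃ y z, evalWord y = b ∧ evalWord z = c ∧ π x = π y + π z := by
  induction x using word_induction with
  | zero =>
    intro b c h
    obtain ⟨rfl, rfl⟩ := hcon b c (by rw [← h, map_zero])
    exact ⟨0, 0, by simp⟩
  | add v x ih =>
    intro b c h
    rw [map_add, evalWord_single, one_nsmul] at h
    obtain ⟨b₁, c₁, b₂, c₂, hv, hx, rfl, rfl⟩ := href _ _ _ _ h
    obtain ⟨y₂, z₂, rfl, rfl, hyz⟩ := ih b₂ c₂ hx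
    obtain ⟨y₁, rfl⟩ := evalWord_surjective hcon href b₁
    obtain ⟨z₁, rfl⟩ := evalWord_surjective hcon href c₁
    refine ⟨y₁ + y₂, z₁ + z₂, map_add _ _ _, map_add _ _ _, ?_⟩
    rw [map_add, hyz, ← map_word_eq_map_vtx hk hw hπ ((map_add _ y₁ z₁).trans hv.symm)]
    simp only [map_add]
    exact add_add_add_comm _ _ _ _

/-- Words with the same value in `M` represent the same element. -/
theorem map_eq_map_of_evalWord_eq (hcon : IsConical M) (href : IsRefinement M)
    (hk : ∀ p, p.1 + (k p + 1) • p.1 = p.1) (hw : Function.Surjective w)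
    (hπ : ∀ v, π (vtx v) = π (vtx v) + π (absorbedWord k w v)) (y : PrimeVertex M →₀ ℕ) :
    ∀ x, evalWord x = evalWord y → π x = π y := by
  induction y using word_induction with
  | zero =>
    intro x hx
    induction x using word_induction with
    | zero => rfl
    | add v x _ =>
      rw [map_add, evalWord_single, one_nsmul, map_zero] at hx
      exact absurd hx (v.1.2.1 _)
  | add v y ih =>
    intro x hx
    rw [map_add, evalWord_single, one_nsmul] at hx
    obtain ⟨s, t, hs, ht, hst⟩ := exists_word_split hcon href hk hw hπ x _ _ hx
    rw [hst, map_add, map_word_eq_map_vtx hk hw hπ hs, ih t ht]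

end Absorption

end Construction

/-- Every finite conical refinement monoid is a graph monoid. -/
theorem finite_conical_refinement_isGraphMonoid (M : Type) [AddCommMonoid M]
    [Finite M] (hcon : IsConical M) (href : IsRefinement M) :
    ∃ G : RowFiniteGraph, Nonempty (M ≃+ graphMonoid G) := by
  classical
  choose k hk using fun p : {p : M // IsPrimeElem p} => (p.2.isRegularElem href).exists_period
  obtain ⟨w, hw⟩ := exists_surjective_nat (PrimeVertex M →₀ ℕ)
  let G := absorptionGraph (absorbedWord k w)
  let π : (PrimeVertex M →₀ ℕ) →+ graphMonoid G := (addConGen (graphRel G)).mk'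
  have hπ (v : PrimeVertex M) : π (vtx v) = π (vtx v) + π (absorbedWord k w v) := by
    rw [← map_add]
    exact (AddCon.eq _).2 (.of _ _ ((graphRel_absorptionGraph _ _ _).2 ⟨v, rfl, rfl⟩))
  have hev : addConGen (graphRel G) ≤ AddCon.ker evalWord := by
    refine AddCon.addConGen_le.2 fun x y hxy => ?_
    obtain ⟨v, rfl, rfl⟩ := (graphRel_absorptionGraph _ _ _).1 hxy
    change evalWord (vtx v) = evalWord (vtx v + absorbedWord k w v)
    rw [map_add, evalWord_single, one_nsmul, add_evalWord_absorbedWord hk]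
  let ev : graphMonoid G →+ M := (addConGen (graphRel G)).lift evalWord hev
  have hevπ (x : PrimeVertex M →₀ ℕ) : ev (π x) = evalWord x := AddCon.lift_mk' hev x
  have hπsurj : Function.Surjective π := AddCon.mk'_surjective
  refine ⟨G, ⟨(AddEquiv.ofBijective ev ⟨fun x y hxy => ?_, fun m => ?_⟩).symm⟩⟩
  · obtain ⟨x, rfl⟩ := hπsurj x
    obtain ⟨y, rfl⟩ := hπsurj y
    rw [hevπ, hevπ] at hxy
    exact map_eq_map_of_evalWord_eq hcon href hk hw hπ y x hxy
  · obtain ⟨x, rfl⟩ := evalWord_surjective hcon href m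
    exact ⟨π x, hevπ x⟩

end ArPardo
end

section
/- Let E be a row-finite directed graph and let H be a hereditary subset of E⁰, with restriction graph E_H. Then the assignment sending the generator a_v of M(E_H) to the element a_v of M(E), for v ∈ H, extends to a monoid isomorphism from the graph monoid M(E_H) onto the order-ideal I(H) of M(E) generated by {a_v : v ∈ H}. -/
namespace ArPardo

theorem mem_edgesFrom {G : RowFiniteGraph} {v : G.V} {e : G.E} :
    e ∈ (G.rowFinite v).toFinset ↔ G.s e = v :=
  Set.Finite.mem_toFinset _

theorem vertexElem_eq_sum (G : RowFiniteGraph) {v : G.V} (hv : ∃ e, G.s e = v) :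
    vertexElem G v = ∑ e ∈ (G.rowFinite v).toFinset, vertexElem G (G.r e) := by
  have h : addConGen (graphRel G) (Finsupp.single v 1)
      (∑ e ∈ (G.rowFinite v).toFinset, Finsupp.single (G.r e) 1) :=
    AddConGen.Rel.of _ _ ⟨v, hv, rfl, rfl⟩
  exact ((AddCon.eq _).2 h).trans (map_sum (addConGen (graphRel G)).mk' _ _)

theorem graphMonoid_induction (G : RowFiniteGraph) {P : graphMonoid G → Prop} (zero : P 0)
    (vertex : ∀ v, P (vertexElem G v)) (add : ∀ x y, P x → P y → P (x + y))
    (x : graphMonoid G) : P x := by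
  obtain ⟨a, rfl⟩ := AddCon.mk'_surjective (c := addConGen (graphRel G)) x
  induction a using Finsupp.induction_linear with
  | zero => exact zero
  | add a b ha hb => exact add _ _ ha hb
  | single v n =>
    induction n with
    | zero =>
      rw [Finsupp.single_zero]
      exact zero
    | succ n ih =>
      rw [Finsupp.single_add]
      exact add _ _ ih (vertex v)

theorem exists_graphMonoid_lift (G : RowFiniteGraph) {N : Type} [AddCommMonoid N] (g : G.V → N)
    (hg : ∀ v, (∃ e, G.s e = v) → g v = ∑ e ∈ (G.rowFinite v).toFinset, g (G.r e)) :
    ∃ f : graphMonoid G →+ N, ∀ v, f (vertexElem G v) = g v := by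
  let F : (G.V →₀ ℕ) →+ N := Finsupp.liftAddHom fun v => multiplesHom N (g v)
  have hF : ∀ v, F (Finsupp.single v 1) = g v := fun v => by simp [F]
  have hle : addConGen (graphRel G) ≤ AddCon.ker F := by
    refine AddCon.addConGen_le.2 ?_
    rintro _ _ ⟨v, hv, rfl, rfl⟩
    rw [AddCon.ker_rel, hF, hg v hv, map_sum]
    exact Finset.sum_congr rfl fun e _ => (hF _).symm
  exact ⟨AddCon.lift _ F hle, hF⟩

theorem sum_restrictGraph_edges (G : RowFiniteGraph) (H : Set G.V)
    (hher : ∀ e : G.E, G.s e ∈ H → G.r e ∈ H) {N : Type} [AddCommMonoid N] (v : ↥H)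
    (g : G.E → N) :
    ∑ e ∈ ((restrictGraph G H hher).rowFinite v).toFinset, g e.1 =
      ∑ e ∈ (G.rowFinite (v : G.V)).toFinset, g e := by
  refine Finset.sum_bij (fun e _ => e.1) ?_ (fun _ _ _ _ h => Subtype.ext h) ?_ fun _ _ => rfl
  · intro e he
    exact mem_edgesFrom.2 (congrArg Subtype.val (mem_edgesFrom.1 he))
  · intro e he
    have hs : G.s e = v := mem_edgesFrom.1 he
    exact ⟨⟨e, hs ▸ v.2⟩, mem_edgesFrom.2 (Subtype.ext hs), rfl⟩

/-- `w` is the range of an edge whose source is the vertex `v` outside `H`. -/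
def StepOutside (G : RowFiniteGraph) (H : Set G.V) (w v : G.V) : Prop :=
  v ∉ H ∧ ∃ e, G.s e = v ∧ G.r e = w

/-- A function on `H` extends to the vertices from which every path reaches `H`, following the
graph relations; all other vertices are sent to `⊤`. -/
theorem exists_withTop_extension (G : RowFiniteGraph) (H : Set G.V) {N : Type} [AddCommMonoid N]
    (g : ↥H → N) :
    ∃ φ : G.V → WithTop N, (∀ v : ↥H, φ v = g v) ∧
      (∀ v ∉ H, (∃ e, G.s e = v) → φ v = ∑ e ∈ (G.rowFinite v).toFinset, φ (G.r e)) ∧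
      ∀ v, φ v ≠ ⊤ → Acc (StepOutside G H) v ∧ (v ∈ H ∨ ∃ e, G.s e = v) := by
  classical
  let step (v : G.V) (rec : ∀ w, StepOutside G H w v → WithTop N) : WithTop N :=
    if hv : v ∈ H then g ⟨v, hv⟩
    else if ∃ e, G.s e = v then
      ∑ e ∈ (G.rowFinite v).toFinset.attach,
        rec (G.r e.1) ⟨hv, e.1, mem_edgesFrom.1 e.2, rfl⟩
    else ⊤
  let φ (v : G.V) : WithTop N :=
    if h : Acc (StepOutside G H) v then WellFounded.fixF step v h else ⊤
  have hφ : ∀ v, Acc (StepOutside G H) v → φ v = step v fun w _ => φ w := by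
    intro v h
    have hrec : (fun w (hw : StepOutside G H w v) => WellFounded.fixF step w (h.inv hw)) =
        fun w _ => φ w := by
      funext w hw
      exact (dif_pos (h.inv hw)).symm
    rw [show φ v = WellFounded.fixF step v h from dif_pos h, WellFounded.fixF_eq, hrec]
  refine ⟨φ, fun v => ?_, fun v hv he => ?_, fun v hv => ?_⟩
  · rw [hφ _ (Acc.intro _ fun w hw => absurd v.2 hw.1)]
    exact dif_pos v.2
  · by_cases h : Acc (StepOutside G H) v
    · rw [hφ v h]
      simp only [step, dif_neg hv, if_pos he]
      exact Finset.sum_attach _ fun e => φ (G.r e)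
    · obtain ⟨w, ⟨-, e, hs, rfl⟩, hw⟩ : ∃ w, StepOutside G H w v ∧ ¬ Acc (StepOutside G H) w := by
        by_contra! hc
        exact h (Acc.intro _ hc)
      rw [show φ v = ⊤ from dif_neg h, eq_comm, WithTop.sum_eq_top]
      exact ⟨e, mem_edgesFrom.2 hs, dif_neg hw⟩
  · have h : Acc (StepOutside G H) v := by
      by_contra h
      exact hv (dif_neg h)
    refine ⟨h, ?_⟩
    by_contra! hc
    refine hv ?_
    rw [hφ v h]
    simp [step, hc.1, hc.2]

/-- For a row-finite graph `E` and a hereditary subset `H` of its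
vertices, the assignment `a_v ↦ a_v` (`v ∈ H`) extends to a monoid isomorphism from
the graph monoid `M(E_H)` of the restriction graph onto the order-ideal `I(H)` of
`M(E)` generated by `{a_v : v ∈ H}`. -/
theorem restrictGraph_monoid_iso_orderIdeal (G : RowFiniteGraph) (H : Set G.V)
    (hher : ∀ e : G.E, G.s e ∈ H → G.r e ∈ H) :
    ∃ f : graphMonoid (restrictGraph G H hher) →+ graphMonoid G,
      (∀ v : ↥H, f (vertexElem (restrictGraph G H hher) v) = vertexElem G (v : G.V)) ∧
      Function.Injective f ∧
      Set.range f = orderIdealGen {x : graphMonoid G | ∃ v ∈ H, x = vertexElem G v} := by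
  obtain ⟨f, hf⟩ := exists_graphMonoid_lift (restrictGraph G H hher)
    (fun v : ↥H => vertexElem G (v : G.V)) (by
      rintro v ⟨e, he⟩
      refine (vertexElem_eq_sum G ⟨e.1, congrArg Subtype.val he⟩).trans ?_
      exact (sum_restrictGraph_edges G H hher v fun e => vertexElem G (G.r e)).symm)
  obtain ⟨φ, hφH, hφsum, hφtop⟩ :=
    exists_withTop_extension G H (vertexElem (restrictGraph G H hher))
  obtain ⟨π, hπ⟩ := exists_graphMonoid_lift G φ (by
    rintro v ⟨e, he⟩
    by_cases hv : v ∈ H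
    · have hsum := vertexElem_eq_sum (restrictGraph G H hher) (v := ⟨v, hv⟩)
        ⟨⟨e, he.symm ▸ hv⟩, Subtype.ext he⟩
      rw [hφH ⟨v, hv⟩, hsum, ← sum_restrictGraph_edges G H hher ⟨v, hv⟩, WithTop.coe_sum]
      exact Finset.sum_congr rfl fun e _ => (hφH _).symm
    · exact hφsum v hv ⟨e, he⟩)
  have hπf : ∀ m, π (f m) = m := by
    refine graphMonoid_induction _ ?_ (fun v => ?_) fun x y hx hy => ?_
    · simp
    · rw [hf, hπ]
      exact hφH v
    · rw [map_add, map_add, hx, hy, WithTop.coe_add]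
  have hvertex : ∀ v, φ v ≠ ⊤ → vertexElem G v ∈ AddMonoidHom.mrange f := by
    intro v hv
    induction (hφtop v hv).1 with
    | intro v _ ih =>
      by_cases hvH : v ∈ H
      · exact ⟨_, hf ⟨v, hvH⟩⟩
      · have he := (hφtop v hv).2.resolve_left hvH
        rw [hφsum v hvH he, WithTop.sum_ne_top] at hv
        rw [vertexElem_eq_sum G he]
        exact sum_mem fun e hs =>
          ih _ ⟨hvH, e, mem_edgesFrom.1 hs, rfl⟩ (hv e hs)
  have hmem : ∀ x, π x ≠ ⊤ → x ∈ AddMonoidHom.mrange f := by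
    refine graphMonoid_induction G (fun _ => zero_mem _) (fun v hv => ?_) fun x y hx hy hxy => ?_
    · exact hvertex v (hπ v ▸ hv)
    · rw [map_add, WithTop.add_ne_top] at hxy
      exact add_mem (hx hxy.1) (hy hxy.2)
  refine ⟨f, hf, fun x y hxy => ?_, Set.Subset.antisymm ?_ ?_⟩
  · exact WithTop.coe_injective (by rw [← hπf x, ← hπf y, hxy])
  · rintro _ ⟨m, rfl⟩ S ⟨⟨hzero, hadd, -⟩, hS⟩
    induction m using graphMonoid_induction with
    | zero => rwa [map_zero]
    | vertex v =>
      obtain ⟨v, hv⟩ := v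
      rw [hf ⟨v, hv⟩]
      exact hS ⟨v, hv, rfl⟩
    | add x y hx hy =>
      rw [map_add]
      exact hadd _ _ hx hy
  · refine Set.sInter_subset_of_mem ⟨⟨⟨0, map_zero f⟩, ?_, ?_⟩, ?_⟩
    · exact fun x y hx hy => (AddMonoidHom.mrange f).add_mem hx hy
    · rintro x _ ⟨z, rfl⟩ ⟨m, hm⟩
      refine hmem x fun hx => WithTop.coe_ne_top (a := m) ?_
      rw [← hπf, hm, map_add, hx, WithTop.top_add]
    · rintro _ ⟨v, hv, rfl⟩
      exact ⟨_, hf ⟨v, hv⟩⟩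

end ArPardo
end
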